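/- Suppose G is a finite measure or h is bounded, and let ε > 0. Assume that for every δ ∈ (0,1) there exists R > 0 such that for all x with ‖x‖ > R and all z with ‖z‖ ≤ ε one has (1−δ)h(x) ≤ h(x+z) ≤ (1+δ)h(x). Then α(h⁻_ε,G) = α(h⁺_ε,G), where h⁺_ε(x) = sup_{‖z‖≤ε} h(x+z) and h⁻_ε(x) = inf_{‖z‖≤ε} h(x+z); consequently, if this holds for every ε > 0 small enough, then α⁻(h,G) = α⁺(h,G). -/

import Mathlib

open MeasureTheory ENNReal Filter

noncomputable section

variable {E : Type*} [NormedAddCommGroup E] [MeasureSpace E]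

/-- The integrand `x ↦ Ḡ(u / h x)` with the conventions `Ḡ(u/h(x)) = 0` when `h x = 0`
and `Ḡ(u/h(x)) = G((0,∞))` when `h x = ∞`. -/
def tailIntegrand (G : Measure ℝ) (h : E → ℝ≥0∞) (u : ℝ) (x : E) : ℝ≥0∞ :=
  if h x = 0 then 0
  else if h x = ⊤ then G (Set.Ioi (0 : ℝ))
  else G (Set.Ioi (u / (h x).toReal))

/-- `α(h,G) = inf{u > 0 : ∫ Ḡ(u/h(x)) dx < ∞}`, with `inf ∅ = ∞` (computed in `ℝ≥0∞`). -/
def alphaCoef (G : Measure ℝ) (h : E → ℝ≥0∞) : ℝ≥0∞ :=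
  sInf (ENNReal.ofReal '' {u : ℝ | 0 < u ∧ (∫⁻ x, tailIntegrand G h u x) < ⊤})

/-- `h⁺_ε(x) = sup_{‖z‖ ≤ ε} h (x + z)` -/
def supBall (h : E → ℝ≥0∞) (ε : ℝ) (x : E) : ℝ≥0∞ :=
  ⨆ z ∈ Metric.closedBall (0 : E) ε, h (x + z)

/-- `h⁻_ε(x) = inf_{‖z‖ ≤ ε} h (x + z)` -/
def infBall (h : E → ℝ≥0∞) (ε : ℝ) (x : E) : ℝ≥0∞ :=
  ⨅ z ∈ Metric.closedBall (0 : E) ε, h (x + z)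

/-- `α⁺(h,G) = α(h⁺,G)` with `h⁺ = h⁺_1`. -/
def alphaPlus (G : Measure ℝ) (h : E → ℝ≥0∞) : ℝ≥0∞ := alphaCoef G (supBall h 1)

/-- `α⁻(h,G) = sup_{ε > 0} α(h⁻_ε, G) = lim_{ε → 0} α(h⁻_ε, G)`. -/
def alphaMinus (G : Measure ℝ) (h : E → ℝ≥0∞) : ℝ≥0∞ :=
  ⨆ ε ∈ Set.Ioi (0 : ℝ), alphaCoef G (infBall h ε)

omit [NormedAddCommGroup E] [MeasureSpace E] in
theorem tailIntegrand_mul_le_of_le_mul (G : Measure ℝ) {h k : E → ℝ≥0∞} {x : E} {c u : ℝ}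
    (hc : 0 < c) (hu : 0 < u) (hk : k x ≤ ENNReal.ofReal c * h x) :
    tailIntegrand G k (c * u) x ≤ tailIntegrand G h u x := by
  unfold tailIntegrand
  by_cases hk0 : k x = 0
  · simp [hk0]
  have hh0 : h x ≠ 0 := fun h0 => hk0 (by simpa [h0] using hk)
  by_cases hht : h x = ⊤
  · rw [if_neg hk0, if_neg hh0, if_pos hht]
    split_ifs
    · exact le_rfl
    · exact measure_mono (Set.Ioi_subset_Ioi (by positivity))
  · have hct : ENNReal.ofReal c * h x ≠ ⊤ := ENNReal.mul_ne_top ENNReal.ofReal_ne_top hht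
    have hkt : k x ≠ ⊤ := ne_top_of_le_ne_top hct hk
    rw [if_neg hk0, if_neg hh0, if_neg hht, if_neg hkt]
    have hkpos : 0 < (k x).toReal := ENNReal.toReal_pos hk0 hkt
    have hhpos : 0 < (h x).toReal := ENNReal.toReal_pos hh0 hht
    have hle : (k x).toReal ≤ c * (h x).toReal := by
      simpa [ENNReal.toReal_mul, ENNReal.toReal_ofReal hc.le] using ENNReal.toReal_mono hct hk
    refine measure_mono (Set.Ioi_subset_Ioi ?_)
    rw [div_le_div_iff₀ hhpos hkpos]
    nlinarith

omit [NormedAddCommGroup E] in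
theorem alphaCoef_mono (G : Measure ℝ) {h k : E → ℝ≥0∞} (hhk : ∀ x, h x ≤ k x) :
    alphaCoef G h ≤ alphaCoef G k := by
  refine sInf_le_sInf (Set.image_mono ?_)
  rintro u ⟨hu, hint⟩
  refine ⟨hu, (lintegral_mono fun x => ?_).trans_lt hint⟩
  simpa using tailIntegrand_mul_le_of_le_mul G (h := k) (k := h) (x := x) one_pos hu
    (by simpa using hhk x)

omit [NormedAddCommGroup E] [MeasureSpace E] in
theorem exists_tailIntegrand_le (G : Measure ℝ) (htail : ∀ u : ℝ, 0 < u → G (Set.Ioi u) < ⊤)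
    {k : E → ℝ≥0∞} (hfin : IsFiniteMeasure G ∨ ∃ B : ℝ≥0∞, B ≠ ⊤ ∧ ∀ x, k x ≤ B)
    {u : ℝ} (hu : 0 < u) : ∃ C : ℝ≥0∞, C ≠ ⊤ ∧ ∀ x, tailIntegrand G k u x ≤ C := by
  rcases hfin with hG | ⟨B, hB, hkB⟩
  · refine ⟨G Set.univ, measure_ne_top G _, fun x => ?_⟩
    unfold tailIntegrand
    split_ifs
    · exact zero_le
    all_goals exact measure_mono (Set.subset_univ _)
  · refine ⟨G (Set.Ioi (u / (B.toReal + 1))), (htail _ (by positivity)).ne, fun x => ?_⟩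
    have hkt : k x ≠ ⊤ := ne_top_of_le_ne_top hB (hkB x)
    unfold tailIntegrand
    rw [if_neg hkt]
    split_ifs with hk0
    · exact zero_le
    · have hkpos : 0 < (k x).toReal := ENNReal.toReal_pos hk0 hkt
      have hle : (k x).toReal ≤ B.toReal := ENNReal.toReal_mono hB (hkB x)
      exact measure_mono (Set.Ioi_subset_Ioi
        (div_le_div_of_nonneg_left hu.le hkpos (by linarith)))

theorem lintegral_tailIntegrand_lt_top_of_le_mul [ProperSpace E] [OpensMeasurableSpace E]
    [IsFiniteMeasureOnCompacts (volume : Measure E)] (G : Measure ℝ)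
    (htail : ∀ u : ℝ, 0 < u → G (Set.Ioi u) < ⊤) {h k : E → ℝ≥0∞}
    (hfin : IsFiniteMeasure G ∨ ∃ B : ℝ≥0∞, B ≠ ⊤ ∧ ∀ x, k x ≤ B) {c u R : ℝ}
    (hc : 0 < c) (hu : 0 < u) (hk : ∀ x, R < ‖x‖ → k x ≤ ENNReal.ofReal c * h x)
    (hint : ∫⁻ x, tailIntegrand G h u x < ⊤) :
    ∫⁻ x, tailIntegrand G k (c * u) x < ⊤ := by
  obtain ⟨C, hC, hkC⟩ := exists_tailIntegrand_le G htail hfin (mul_pos hc hu)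
  have hball : MeasurableSet (Metric.closedBall (0 : E) R) :=
    Metric.isClosed_closedBall.measurableSet
  calc ∫⁻ x, tailIntegrand G k (c * u) x
      ≤ ∫⁻ x, ((Metric.closedBall (0 : E) R).indicator (fun _ => C) x
          + tailIntegrand G h u x) := by
        refine lintegral_mono fun x => ?_
        by_cases hx : x ∈ Metric.closedBall (0 : E) R
        · simpa [Set.indicator_of_mem hx] using le_add_right (hkC x)
        · rw [Set.indicator_of_notMem hx, zero_add]
          rw [mem_closedBall_zero_iff, not_le] at hx
          exact tailIntegrand_mul_le_of_le_mul G hc hu (hk x hx)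
    _ = C * volume (Metric.closedBall (0 : E) R) + ∫⁻ x, tailIntegrand G h u x := by
        rw [lintegral_add_left (measurable_const.indicator hball),
          lintegral_indicator_const hball]
    _ < ⊤ := ENNReal.add_lt_top.2 ⟨ENNReal.mul_lt_top hC.lt_top
        (isCompact_closedBall (0 : E) R).measure_lt_top, hint⟩

theorem alphaCoef_le_of_forall_eventually_le_mul [ProperSpace E] [OpensMeasurableSpace E]
    [IsFiniteMeasureOnCompacts (volume : Measure E)] (G : Measure ℝ)
    (htail : ∀ u : ℝ, 0 < u → G (Set.Ioi u) < ⊤) {h k : E → ℝ≥0∞}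
    (hfin : IsFiniteMeasure G ∨ ∃ B : ℝ≥0∞, B ≠ ⊤ ∧ ∀ x, k x ≤ B)
    (hk : ∀ c : ℝ, 1 < c → ∃ R : ℝ, ∀ x, R < ‖x‖ → k x ≤ ENNReal.ofReal c * h x) :
    alphaCoef G k ≤ alphaCoef G h := by
  refine le_sInf ?_
  rintro _ ⟨u, ⟨hu, hint⟩, rfl⟩
  refine ENNReal.le_of_forall_pos_le_add fun η hη _ => ?_
  have hη' : (0 : ℝ) < η := hη
  have hc : 1 < (u + η) / u := (one_lt_div hu).2 (by linarith)
  obtain ⟨R, hR⟩ := hk _ hc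
  have hlt := lintegral_tailIntegrand_lt_top_of_le_mul G htail hfin (by linarith) hu hR hint
  rw [div_mul_cancel₀ _ hu.ne'] at hlt
  calc alphaCoef G k ≤ ENNReal.ofReal (u + η) := sInf_le ⟨_, ⟨by linarith, hlt⟩, rfl⟩
    _ = ENNReal.ofReal u + η := by
        rw [ENNReal.ofReal_add hu.le hη'.le, ENNReal.ofReal_coe_nnreal]

/-- Proposition 2.8 (2): if `G` is finite or `h` is bounded, `ε > 0`, and for every
`δ ∈ (0,1)` there is `R > 0` with `(1-δ)h(x) ≤ h(x+z) ≤ (1+δ)h(x)` for all `‖x‖ > R`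
and `‖z‖ ≤ ε`, then `α(h⁻_ε,G) = α(h⁺_ε,G)`. -/
theorem alpha_infBall_eq_alpha_supBall
    {d : ℕ} (hd : 1 ≤ d) (G : Measure ℝ) (h : EuclideanSpace ℝ (Fin d) → ℝ≥0∞)
    (hmeas : Measurable h)
    (htail : ∀ u : ℝ, 0 < u → G (Set.Ioi u) < ⊤)
    (hfin : IsFiniteMeasure G ∨ ∃ B : ℝ≥0∞, B ≠ ⊤ ∧ ∀ x, h x ≤ B)
    (ε : ℝ) (hε : 0 < ε)
    (hcomp : ∀ δ : ℝ, 0 < δ → δ < 1 → ∃ R : ℝ, 0 < R ∧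
      ∀ x : EuclideanSpace ℝ (Fin d), R < ‖x‖ →
        ∀ z : EuclideanSpace ℝ (Fin d), ‖z‖ ≤ ε →
          ENNReal.ofReal (1 - δ) * h x ≤ h (x + z) ∧
          h (x + z) ≤ ENNReal.ofReal (1 + δ) * h x) :
    alphaCoef G (infBall h ε) = alphaCoef G (supBall h ε) := by
  refine le_antisymm (alphaCoef_mono G fun x => ?_) ?_
  · have h0 : (0 : EuclideanSpace ℝ (Fin d)) ∈ Metric.closedBall 0 ε :=
      Metric.mem_closedBall_self hε.le
    exact (iInf₂_le (f := fun z _ => h (x + z)) 0 h0).trans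
      (le_iSup₂ (f := fun z _ => h (x + z)) 0 h0)
  · refine alphaCoef_le_of_forall_eventually_le_mul G htail ?_ fun c hc => ?_
    · exact hfin.imp_right fun ⟨B, hB, hhB⟩ => ⟨B, hB, fun x => iSup₂_le fun z _ => hhB _⟩
    · have hc1 : 0 < c + 1 := by linarith
      obtain ⟨R, -, hR⟩ := hcomp ((c - 1) / (c + 1)) (div_pos (by linarith) hc1)
        ((div_lt_one hc1).2 (by linarith))
      refine ⟨R, fun x hx => ?_⟩
      have hsup : supBall h ε x ≤ ENNReal.ofReal (1 + (c - 1) / (c + 1)) * h x :=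
        iSup₂_le fun z hz => (hR x hx z (mem_closedBall_zero_iff.1 hz)).2
      have hinf : ENNReal.ofReal (1 - (c - 1) / (c + 1)) * h x ≤ infBall h ε x :=
        le_iInf₂ fun z hz => (hR x hx z (mem_closedBall_zero_iff.1 hz)).1
      have hδ : 1 + (c - 1) / (c + 1) = c * (1 - (c - 1) / (c + 1)) := by
        field_simp
        ring
      rw [hδ, ENNReal.ofReal_mul (by linarith), mul_assoc] at hsup
      exact hsup.trans (by gcongr)
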